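/- Let X be a finite (q+1)-regular graph on n vertices satisfying the Sarnak-Xue weak injective radius property with parameter A ∈ (0,1]: for every k ≤ 2A·log_q(n) and ε > 0, P(X,k) ≪_ε n^{1+ε}q^{k/2}. Then X satisfies the Sarnak-Xue density property with parameter A: for every p > 2 and ε > 0, #{i : p_i ≥ p} ≪_ε n^{1−A(1−2/p)+ε}. -/

import Mathlib

open scoped Classical

/-- Number of non-backtracking paths of length `k` from `x` to `y` in `G`. -/
noncomputable def nbCount {V : Type*} [Fintype V] (G : SimpleGraph V) (k : ℕ)
    (x y : V) : ℕ :=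
  (Finset.univ.filter (fun w : Fin (k + 1) → V =>
    w 0 = x ∧ w (Fin.last k) = y ∧
    (∀ i : Fin k, G.Adj (w i.castSucc) (w i.succ)) ∧
    (∀ i j : Fin (k + 1), (j : ℕ) = (i : ℕ) + 2 → w j ≠ w i))).card

/-- `P(X,k)`: the number of closed non-backtracking paths of length `k` in `G`. -/
noncomputable def PX {V : Type*} [Fintype V] (G : SimpleGraph V) (k : ℕ) : ℕ :=
  ∑ x, nbCount G k x x

/-- The reciprocal `1/p` of the `p`-value of a normalized adjacency eigenvalue. -/
noncomputable def pexp (q : ℕ) (lam : ℝ) : ℝ :=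
  if |lam| ≤ 2 * Real.sqrt q / ((q : ℝ) + 1) then 1 / 2
  else 1 - Real.logb q
    ((((q : ℝ) + 1) * |lam| + Real.sqrt (((q : ℝ) + 1) ^ 2 * lam ^ 2 - 4 * q)) / 2)

/-- A sequence of `k + 1` vertices is a non-backtracking path of `G`. -/
def IsNonbacktracking {V : Type*} (G : SimpleGraph V) (k : ℕ) (w : Fin (k + 1) → V) : Prop :=
  (∀ i : Fin k, G.Adj (w i.castSucc) (w i.succ)) ∧
    ∀ i j : Fin (k + 1), (j : ℕ) = (i : ℕ) + 2 → w j ≠ w i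

/-- Number of non-backtracking paths of length `k + 1` from `x` to `y` with first step `x → z`. -/
noncomputable def nbCountStep {V : Type*} [Fintype V] (G : SimpleGraph V) (k : ℕ)
    (x z y : V) : ℕ :=
  (Finset.univ.filter (fun w : Fin (k + 2) → V =>
    w 0 = x ∧ w 1 = z ∧ w (Fin.last (k + 1)) = y ∧ IsNonbacktracking G (k + 1) w)).card

section Counting

variable {V : Type*} [Fintype V] (G : SimpleGraph V)

theorem isNonbacktracking_cons {V : Type*} (G : SimpleGraph V) (k : ℕ) (x : V)
    (w : Fin (k + 2) → V) :
    IsNonbacktracking G (k + 2) (Fin.cons x w : Fin (k + 3) → V) ↔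
      G.Adj x (w 0) ∧ w 1 ≠ x ∧ IsNonbacktracking G (k + 1) w := by
  unfold IsNonbacktracking
  rw [Fin.forall_fin_succ (n := k + 1), Fin.forall_fin_succ (n := k + 2)]
  have hs : ∀ i : Fin (k + 1), (Fin.cons x w : Fin (k + 3) → V) i.succ.castSucc = w i.castSucc :=
    fun i => by rw [← Fin.succ_castSucc, Fin.cons_succ]
  have h0 : (∀ j : Fin (k + 3), (j : ℕ) = ((0 : Fin (k + 3)) : ℕ) + 2 →
      (Fin.cons x w : Fin (k + 3) → V) j ≠ (Fin.cons x w : Fin (k + 3) → V) 0) ↔ w 1 ≠ x := by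
    constructor
    · intro h
      exact h (Fin.succ 1) (by simp)
    · intro h j hj
      obtain rfl : j = Fin.succ 1 := Fin.ext (by simpa [Nat.mod_eq_of_lt] using hj)
      exact h
  have h1 : (∀ i : Fin (k + 2), ∀ j : Fin (k + 3), (j : ℕ) = (i.succ : ℕ) + 2 →
      (Fin.cons x w : Fin (k + 3) → V) j ≠ (Fin.cons x w : Fin (k + 3) → V) i.succ) ↔
      ∀ i j : Fin (k + 2), (j : ℕ) = (i : ℕ) + 2 → w j ≠ w i := by
    refine forall_congr' fun i => ?_
    rw [Fin.forall_fin_succ]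
    simp only [Fin.cons_succ, Fin.val_succ, Fin.val_zero]
    constructor
    · rintro ⟨-, h⟩ j hj
      exact h j (by omega)
    · exact fun h => ⟨fun h' => by omega, fun j hj => h j (by omega)⟩
  rw [h0, h1]
  simp only [Fin.cons_succ, hs, Fin.castSucc_zero, Fin.cons_zero]
  tauto

theorem nbCountStep_eq_zero {x z : V} (h : ¬ G.Adj x z) (k : ℕ) (y : V) :
    nbCountStep G k x z y = 0 := by
  rw [nbCountStep, Finset.card_eq_zero, Finset.filter_eq_empty_iff]
  rintro w - ⟨rfl, rfl, -, hw, -⟩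
  exact h (by simpa using hw 0)

theorem nbCount_succ (k : ℕ) (x y : V) :
    nbCount G (k + 1) x y = ∑ z, nbCountStep G k x z y := by
  rw [nbCount, Finset.card_eq_sum_card_fiberwise (f := fun w => w 1) (t := Finset.univ)
    (fun _ _ => Finset.mem_coe.2 (Finset.mem_univ _))]
  refine Finset.sum_congr rfl fun z _ => ?_
  rw [nbCountStep, Finset.filter_filter]
  congr 1
  ext w
  simp only [Finset.mem_filter, Finset.mem_univ, true_and]
  unfold IsNonbacktracking
  tauto

theorem nbCountStep_succ {x z : V} (h : G.Adj x z) (k : ℕ) (y : V) :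
    nbCountStep G (k + 1) x z y + nbCountStep G k z x y = nbCount G (k + 1) z y := by
  have hcard : nbCountStep G (k + 1) x z y =
      (Finset.univ.filter (fun w : Fin (k + 2) → V => w 0 = z ∧ w 1 ≠ x ∧
        w (Fin.last (k + 1)) = y ∧ IsNonbacktracking G (k + 1) w)).card := by
    symm
    refine Finset.card_bij (fun w _ => (Fin.cons x w : Fin (k + 3) → V)) ?_ ?_ ?_
    · intro w hw
      simp only [Finset.mem_filter, Finset.mem_univ, true_and] at hw ⊢
      obtain ⟨rfl, h1, h2, h3⟩ := hw
      exact ⟨Fin.cons_zero _ _, Fin.cons_succ _ _ 0,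
        by rw [← Fin.succ_last, Fin.cons_succ, h2],
        (isNonbacktracking_cons G k x w).2 ⟨h, h1, h3⟩⟩
    · intro w _ w' _ hww
      exact Fin.cons_right_injective (α := fun _ => V) x hww
    · intro w hw
      simp only [Finset.mem_filter, Finset.mem_univ, true_and] at hw
      obtain ⟨rfl, rfl, h2, h3⟩ := hw
      rw [← Fin.cons_self_tail w] at h3
      have h4 := (isNonbacktracking_cons G k (w 0) (Fin.tail w)).1 h3
      refine ⟨Fin.tail w, ?_, Fin.cons_self_tail w⟩
      simp only [Finset.mem_filter, Finset.mem_univ, true_and]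
      exact ⟨rfl, h4.2.1, h2, h4.2.2⟩
  conv_rhs => rw [nbCount, ← Finset.card_filter_add_card_filter_not (fun w => w 1 ≠ x),
    Finset.filter_filter, Finset.filter_filter]
  rw [hcard, nbCountStep]
  congr 1 <;>
  · congr 1
    ext w
    simp only [Finset.mem_filter, Finset.mem_univ, true_and, not_not]
    unfold IsNonbacktracking
    tauto

/-- The matrix of numbers of non-backtracking paths of length `k`. -/
noncomputable def nbMatrix (k : ℕ) : Matrix V V ℝ :=
  Matrix.of fun x y => (nbCount G k x y : ℝ)

theorem nbMatrix_zero : nbMatrix G 0 = 1 := by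
  ext x y
  rw [nbMatrix, Matrix.of_apply, nbCount, Matrix.one_apply]
  split_ifs with h
  · subst h
    rw [Nat.cast_eq_one, Finset.card_eq_one]
    refine ⟨fun _ => x, ?_⟩
    ext w
    simp only [Finset.mem_filter, Finset.mem_univ, true_and, Finset.mem_singleton]
    constructor
    · rintro ⟨h, -⟩
      ext i
      rw [Fin.eq_zero i, h]
    · rintro rfl
      exact ⟨rfl, rfl, fun i => i.elim0, fun i j hij => by omega⟩
  · rw [Nat.cast_eq_zero, Finset.card_eq_zero, Finset.filter_eq_empty_iff]
    rintro w - ⟨h0, h1, -⟩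
    exact h (h0.symm.trans h1)

theorem nbCountStep_zero {x z : V} (h : G.Adj x z) (y : V) :
    nbCountStep G 0 x z y = if z = y then 1 else 0 := by
  rw [nbCountStep]
  split_ifs with hz
  · subst hz
    rw [Finset.card_eq_one]
    refine ⟨![x, z], ?_⟩
    ext w
    simp only [Finset.mem_filter, Finset.mem_univ, true_and, Finset.mem_singleton]
    constructor
    · rintro ⟨rfl, rfl, -⟩
      ext i
      fin_cases i <;> rfl
    · rintro rfl
      refine ⟨rfl, rfl, rfl, fun i => ?_, fun i j hij => by omega⟩
      rw [Fin.eq_zero i]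
      exact h
  · rw [Finset.card_eq_zero, Finset.filter_eq_empty_iff]
    rintro w - ⟨-, h0, h1, -⟩
    exact hz (h0.symm.trans h1)

theorem sum_neighborFinset_nbCountStep (k : ℕ) (x y : V) :
    ∑ z ∈ G.neighborFinset x, nbCountStep G k x z y = nbCount G (k + 1) x y := by
  rw [nbCount_succ]
  refine Finset.sum_subset (Finset.subset_univ _) fun z _ hz => ?_
  exact nbCountStep_eq_zero G (by simpa using hz) k y

theorem nbMatrix_one : nbMatrix G 1 = G.adjMatrix ℝ := by
  ext x y
  rw [nbMatrix, Matrix.of_apply, ← sum_neighborFinset_nbCountStep,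
    Finset.sum_congr rfl fun z hz => nbCountStep_zero G (by simpa using hz) y]
  simp [SimpleGraph.adjMatrix_apply]

theorem nbCount_add_two (k : ℕ) (x y : V) :
    nbCount G (k + 2) x y + ∑ z ∈ G.neighborFinset x, nbCountStep G k z x y =
      ∑ z ∈ G.neighborFinset x, nbCount G (k + 1) z y := by
  rw [← sum_neighborFinset_nbCountStep, ← Finset.sum_add_distrib]
  exact Finset.sum_congr rfl fun z hz => nbCountStep_succ G (by simpa using hz) k y

variable {G} {q : ℕ}

theorem nbMatrix_two (hG : G.IsRegularOfDegree (q + 1)) :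
    nbMatrix G 2 = G.adjMatrix ℝ * G.adjMatrix ℝ - ((q : ℝ) + 1) • 1 := by
  rw [eq_sub_iff_add_eq]
  ext x y
  have h := nbCount_add_two G 0 x y
  rw [Finset.sum_congr rfl fun z hz =>
    nbCountStep_zero G (x := z) (z := x) (by simpa [G.adj_comm] using hz) y,
    Finset.sum_const, G.card_neighborFinset_eq_degree, hG.degree_eq] at h
  rw [SimpleGraph.adjMatrix_mul_apply, ← nbMatrix_one]
  simp only [nbMatrix, Matrix.add_apply, Matrix.of_apply, Matrix.smul_apply, Matrix.one_apply]
  have h' := congrArg (Nat.cast : ℕ → ℝ) h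
  push_cast at h'
  simpa [mul_ite] using h'

theorem nbMatrix_add_three (hG : G.IsRegularOfDegree (q + 1)) (k : ℕ) :
    nbMatrix G (k + 3) = G.adjMatrix ℝ * nbMatrix G (k + 2) - (q : ℝ) • nbMatrix G (k + 1) := by
  rw [eq_sub_iff_add_eq]
  ext x y
  have h := nbCount_add_two G (k + 1) x y
  have h1 : ∑ z ∈ G.neighborFinset x, nbCountStep G (k + 1) z x y =
      q * nbCount G (k + 1) x y := by
    have h2 := Finset.sum_congr rfl fun z (hz : z ∈ G.neighborFinset x) =>
      nbCountStep_succ G (x := z) (z := x) (by simpa [G.adj_comm] using hz) k y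
    rw [Finset.sum_add_distrib, sum_neighborFinset_nbCountStep, Finset.sum_const,
      G.card_neighborFinset_eq_degree, hG.degree_eq, smul_eq_mul] at h2
    linarith
  rw [h1] at h
  rw [SimpleGraph.adjMatrix_mul_apply]
  simp only [nbMatrix, Matrix.add_apply, Matrix.of_apply, Matrix.smul_apply, smul_eq_mul]
  exact_mod_cast h

end Counting

section Spectral

open Polynomial

/-- The polynomials expressing non-backtracking path counts of a `(q + 1)`-regular graph in terms
of its adjacency matrix. -/
noncomputable def nbPoly (q : ℝ) : ℕ → ℝ[X]
  | 0 => 1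
  | 1 => X
  | 2 => X * X - C (q + 1)
  | k + 3 => X * nbPoly q (k + 2) - C q * nbPoly q (k + 1)

theorem aeval_nbPoly_adjMatrix {V : Type*} [Fintype V] {G : SimpleGraph V} {q : ℕ}
    (hG : G.IsRegularOfDegree (q + 1)) (k : ℕ) :
    aeval (G.adjMatrix ℝ) (nbPoly q k) = nbMatrix G k := by
  induction k using Nat.strong_induction_on with
  | _ k ih =>
    match k, ih with
    | 0, _ => simp [nbPoly, nbMatrix_zero]
    | 1, _ => simp [nbPoly, nbMatrix_one]
    | 2, _ =>
      rw [nbPoly, nbMatrix_two hG, map_sub, map_mul, aeval_X, aeval_C,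
        Algebra.algebraMap_eq_smul_one]
    | k + 3, ih =>
      rw [nbPoly, map_sub, map_mul, map_mul, ih (k + 2) (by omega), ih (k + 1) (by omega),
        nbMatrix_add_three hG, aeval_X, aeval_C, ← Algebra.smul_def]

theorem Matrix.IsHermitian.trace_aeval {n : Type*} [Fintype n] [DecidableEq n]
    {M : Matrix n n ℝ} (hM : M.IsHermitian) (f : ℝ[X]) :
    (aeval M f).trace = ∑ i, f.eval (hM.eigenvalues i) := by
  conv_lhs => rw [hM.spectral_theorem]
  have h1 : aeval (Unitary.conjStarAlgAut ℝ _ hM.eigenvectorUnitary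
      (Matrix.diagonal ((RCLike.ofReal : ℝ → ℝ) ∘ hM.eigenvalues))) f =
      Unitary.conjStarAlgAut ℝ _ hM.eigenvectorUnitary
        (Matrix.diagonal fun i => f.eval (hM.eigenvalues i)) := by
    rw [aeval_algHom_apply (Unitary.conjStarAlgAut ℝ _ hM.eigenvectorUnitary)]
    congr 1
    have h2 := aeval_algHom_apply (Matrix.diagonalAlgHom (n := n) (α := ℝ) ℝ)
      ((RCLike.ofReal : ℝ → ℝ) ∘ hM.eigenvalues) f
    rw [Matrix.diagonalAlgHom_apply] at h2
    rw [h2, Matrix.diagonalAlgHom_apply]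
    congr 1
    ext i
    simp [aeval_fn_apply]
  rw [h1, Unitary.conjStarAlgAut_apply, Matrix.trace_mul_comm, ← mul_assoc]
  simp [Matrix.trace]

theorem roots_prod_univ_X_sub_C {ι : Type*} [Fintype ι] (μ : ι → ℝ) :
    (∏ i, (X - C (μ i))).roots = Finset.univ.val.map μ := by
  rw [← roots_multiset_prod_X_sub_C (Finset.univ.val.map μ), Multiset.map_map]
  rfl

theorem Matrix.IsHermitian.trace_aeval_of_charpoly_eq {n ι : Type*} [Fintype n] [DecidableEq n]
    [Fintype ι] {M : Matrix n n ℝ} (hM : M.IsHermitian) {μ : ι → ℝ}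
    (hμ : M.charpoly = ∏ i, (X - C (μ i))) (f : ℝ[X]) :
    (aeval M f).trace = ∑ i, f.eval (μ i) := by
  have h : (Finset.univ.val.map μ) = Finset.univ.val.map hM.eigenvalues := by
    have h1 := hM.roots_charpoly_eq_eigenvalues
    rw [hμ, roots_prod_univ_X_sub_C] at h1
    simpa using h1
  rw [hM.trace_aeval f]
  have h3 := congrArg (fun s => (s.map fun a => f.eval a).sum) h
  rw [Multiset.map_map, Multiset.map_map] at h3
  exact h3.symm

theorem PX_eq_sum_eval_nbPoly {V : Type*} [Fintype V] {G : SimpleGraph V} {q : ℕ}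
    (hG : G.IsRegularOfDegree (q + 1)) {ι : Type*} [Fintype ι] {μ : ι → ℝ}
    (hμ : (G.adjMatrix ℝ).charpoly = ∏ i, (X - C (μ i))) (k : ℕ) :
    (PX G k : ℝ) = ∑ i, (nbPoly q k).eval (μ i) := by
  have hM : (G.adjMatrix ℝ).IsHermitian := by
    rw [Matrix.IsHermitian, Matrix.conjTranspose_eq_transpose_of_trivial, G.transpose_adjMatrix]
  rw [← hM.trace_aeval_of_charpoly_eq hμ, aeval_nbPoly_adjMatrix hG]
  simp [PX, Matrix.trace, nbMatrix]

/-- The complete homogeneous symmetric polynomial of degree `k` in two variables. -/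
def homogSum {R : Type*} [CommRing R] (s r : R) : ℕ → R
  | 0 => 1
  | k + 1 => s * homogSum s r k + r ^ (k + 1)

theorem homogSum_neg {R : Type*} [CommRing R] (s r : R) (k : ℕ) :
    homogSum (-s) (-r) k = (-1) ^ k * homogSum s r k := by
  induction k with
  | zero => simp [homogSum]
  | succ k ih =>
    rw [homogSum, homogSum, ih, neg_pow r]
    ring

theorem homogSum_nonneg {s r : ℝ} (hs : 0 ≤ s) (hr : 0 ≤ r) (k : ℕ) : 0 ≤ homogSum s r k := by
  induction k with
  | zero => simp [homogSum]
  | succ k ih =>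
    rw [homogSum]
    positivity

theorem norm_homogSum_le {s r : ℂ} {c : ℝ} (hs : ‖s‖ = c) (hr : ‖r‖ = c) (k : ℕ) :
    ‖homogSum s r k‖ ≤ (k + 1) * c ^ k := by
  have hc : 0 ≤ c := hs ▸ norm_nonneg s
  induction k with
  | zero => simp [homogSum]
  | succ k ih =>
    rw [homogSum]
    calc ‖s * homogSum s r k + r ^ (k + 1)‖ ≤ c * ‖homogSum s r k‖ + c ^ (k + 1) := by
          refine (norm_add_le _ _).trans ?_
          rw [norm_mul, norm_pow, hs, hr]
      _ ≤ c * ((k + 1) * c ^ k) + c ^ (k + 1) := by gcongr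
      _ = ((k + 1 : ℕ) + 1) * c ^ (k + 1) := by push_cast; ring

theorem aeval_nbPoly_add_two {R : Type*} [CommRing R] [Algebra ℝ R] {q : ℝ} {s r : R}
    (h : s * r = algebraMap ℝ R q) (k : ℕ) :
    aeval (s + r) (nbPoly q (k + 2)) =
      s ^ (k + 2) + r ^ (k + 2) + (algebraMap ℝ R q - 1) * homogSum s r k := by
  induction k using Nat.strong_induction_on with
  | _ k ih =>
    match k, ih with
    | 0, _ =>
      simp only [nbPoly, homogSum, map_sub, map_mul, map_add, map_one, aeval_X, aeval_C, ← h]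
      ring
    | 1, _ =>
      simp only [nbPoly, homogSum, map_sub, map_mul, map_add, map_one, aeval_X, aeval_C, ← h]
      ring
    | k + 2, ih =>
      rw [nbPoly, map_sub, map_mul, map_mul, aeval_X, aeval_C, ih (k + 1) (by omega),
        ih k (by omega), ← h]
      simp only [homogSum]
      ring

theorem pow_le_eval_nbPoly {q : ℝ} (hq : 1 ≤ q) {s : ℝ} (hs : 0 < s) {μ : ℝ}
    (hμ : |μ| = s + q / s) {k : ℕ} (hk : Even k) :
    s ^ (k + 2) ≤ (nbPoly q (k + 2)).eval μ := by
  have hr : 0 ≤ q / s := by positivity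
  have hsr : s * (q / s) = q := by field_simp
  have key : (nbPoly q (k + 2)).eval μ =
      s ^ (k + 2) + (q / s) ^ (k + 2) + (q - 1) * homogSum s (q / s) k := by
    rcases abs_choice μ with h | h
    · rw [← h, hμ]
      simpa using aeval_nbPoly_add_two (R := ℝ) (q := q) hsr k
    · have h1 : μ = -s + -(q / s) := by linarith
      have h2 := aeval_nbPoly_add_two (R := ℝ) (q := q) (s := -s) (r := -(q / s))
        (by rw [neg_mul_neg]; exact hsr) k
      have hk2 : Even (k + 2) := hk.add even_two
      rw [homogSum_neg, hk2.neg_pow, hk2.neg_pow, hk.neg_one_pow, one_mul, ← h1] at h2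
      simpa using h2
  rw [key]
  have h3 := mul_nonneg (sub_nonneg.2 hq) (homogSum_nonneg hs.le hr k)
  have h4 := pow_nonneg hr (k + 2)
  linarith

theorem abs_eval_nbPoly_le {q : ℝ} (hq : 1 ≤ q) {μ : ℝ} (hμ : |μ| ≤ 2 * √q) (k : ℕ) :
    |(nbPoly q (k + 2)).eval μ| ≤ (k + 3) * √q ^ (k + 2) := by
  have hq0 : 0 ≤ q := by linarith
  have hsq : √q ^ 2 = q := Real.sq_sqrt hq0
  have hμ2 : μ ^ 2 ≤ 4 * q := by
    have := pow_le_pow_left₀ (abs_nonneg μ) hμ 2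
    rw [sq_abs, mul_pow, hsq] at this
    linarith
  set d : ℝ := √(4 * q - μ ^ 2) with hd
  have hd2 : d ^ 2 = 4 * q - μ ^ 2 := Real.sq_sqrt (by linarith)
  set s : ℂ := ⟨μ / 2, d / 2⟩ with hs
  set r : ℂ := ⟨μ / 2, -(d / 2)⟩ with hr
  have hns : ‖s‖ = √q := by
    rw [Complex.norm_def, Complex.normSq_apply]
    congr 1
    simp only [hs]
    linear_combination hd2 / 4
  have hnr : ‖r‖ = √q := by
    rw [Complex.norm_def, Complex.normSq_apply]
    congr 1
    simp only [hr]
    linear_combination hd2 / 4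
  have hsr : s * r = algebraMap ℝ ℂ q := by
    apply Complex.ext
    · simp [hs, hr]
      linear_combination hd2 / 4
    · simp [hs, hr]
      ring
  have hadd : s + r = algebraMap ℝ ℂ μ := by
    apply Complex.ext <;> simp [hs, hr]
  have key := aeval_nbPoly_add_two hsr k
  rw [hadd, aeval_algebraMap_apply] at key
  have hnorm : |(nbPoly q (k + 2)).eval μ| =
      ‖s ^ (k + 2) + r ^ (k + 2) + (algebraMap ℝ ℂ q - 1) * homogSum s r k‖ := by
    rw [← key]
    simp
  have hq1 : ‖(algebraMap ℝ ℂ q - 1)‖ = q - 1 := by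
    rw [← map_one (algebraMap ℝ ℂ), ← map_sub, norm_algebraMap', Real.norm_eq_abs,
      abs_of_nonneg (by linarith)]
  rw [hnorm]
  calc _ ≤ ‖s‖ ^ (k + 2) + ‖r‖ ^ (k + 2) + (q - 1) * ‖homogSum s r k‖ := by
        refine (norm_add₃_le).trans ?_
        rw [norm_mul, norm_pow, norm_pow, hq1]
    _ ≤ √q ^ (k + 2) + √q ^ (k + 2) + q * ((k + 1) * √q ^ k) := by
        rw [hns, hnr]
        gcongr
        · linarith
        · exact norm_homogSum_le hns hnr k
    _ = (k + 3) * √q ^ (k + 2) := by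
        rw [pow_add, hsq]
        ring

end Spectral

section Density

theorem abs_eq_add_div_of_lt {q μ : ℝ} (hq : 0 < q) (hμ : 2 * √q < |μ|) :
    0 < (|μ| + √(μ ^ 2 - 4 * q)) / 2 ∧
      |μ| = (|μ| + √(μ ^ 2 - 4 * q)) / 2 + q / ((|μ| + √(μ ^ 2 - 4 * q)) / 2) := by
  have hμ2 : 4 * q ≤ μ ^ 2 := by
    have := pow_le_pow_left₀ (by positivity) hμ.le 2
    rw [sq_abs, mul_pow, Real.sq_sqrt hq.le] at this
    linarith
  have hd := Real.sq_sqrt (sub_nonneg.2 hμ2)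
  have habs : 0 < |μ| := lt_of_le_of_lt (by positivity) hμ
  have hpos : 0 < (|μ| + √(μ ^ 2 - 4 * q)) / 2 := by positivity
  refine ⟨hpos, ?_⟩
  rw [← sub_eq_iff_eq_add', eq_div_iff hpos.ne']
  linear_combination (sq_abs μ - hd) / 4

theorem neg_le_eval_nbPoly {q : ℝ} (hq : 1 ≤ q) (μ : ℝ) {k : ℕ} (hk : Even k) :
    -((k + 3) * √q ^ (k + 2)) ≤ (nbPoly q (k + 2)).eval μ := by
  rcases le_or_gt |μ| (2 * √q) with h | h
  · exact (abs_le.1 (abs_eval_nbPoly_le hq h k)).1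
  · obtain ⟨hs, hμ⟩ := abs_eq_add_div_of_lt (by linarith) h
    have h1 := pow_le_eval_nbPoly hq hs hμ hk
    have h2 := pow_nonneg hs.le (k + 2)
    have h3 : 0 ≤ (k + 3) * √q ^ (k + 2) := by positivity
    linarith

theorem rpow_pow_le_eval_nbPoly {q : ℕ} (hq : 2 ≤ q) {p : ℝ} (hp : 2 < p) {lam : ℝ}
    (hlam : pexp q lam ≤ 1 / p) {k : ℕ} (hk : Even k) :
    ((q : ℝ) ^ (1 - 1 / p)) ^ (k + 2) ≤ (nbPoly q (k + 2)).eval (((q : ℝ) + 1) * lam) := by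
  have hq2 : (2 : ℝ) ≤ q := by exact_mod_cast hq
  have hq1 : (0 : ℝ) < q + 1 := by positivity
  unfold pexp at hlam
  split_ifs at hlam with h
  · have := one_div_lt_one_div_of_lt two_pos hp
    linarith
  · have habs : |((q : ℝ) + 1) * lam| = ((q : ℝ) + 1) * |lam| := by
      rw [abs_mul, abs_of_pos hq1]
    have hlt : 2 * √(q : ℝ) < |((q : ℝ) + 1) * lam| := by
      rw [not_le, div_lt_iff₀ hq1] at h
      rw [habs]
      linarith
    rw [← habs, ← mul_pow] at hlam
    obtain ⟨hs, hμ⟩ := abs_eq_add_div_of_lt (by linarith) hlt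
    refine le_trans ?_ (pow_le_eval_nbPoly (by linarith) hs hμ hk)
    refine pow_le_pow_left₀ (by positivity) ?_ _
    rw [← Real.le_logb_iff_rpow_le (by linarith) hs]
    linarith

theorem card_mul_rpow_le {V : Type*} [Fintype V] {G : SimpleGraph V} {q : ℕ} (hq : 2 ≤ q)
    (hG : G.IsRegularOfDegree (q + 1)) {lam : Fin (Fintype.card V) → ℝ}
    (hlam : (G.adjMatrix ℝ).charpoly =
      ∏ i, (Polynomial.X - Polynomial.C (((q : ℝ) + 1) * lam i)))
    {p : ℝ} (hp : 2 < p) {k : ℕ} (hk : Even k) :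
    ((Finset.univ.filter (fun i => pexp q (lam i) ≤ 1 / p)).card : ℝ) *
        ((q : ℝ) ^ (1 - 1 / p)) ^ (k + 2) ≤
      PX G (k + 2) + Fintype.card V * ((k + 3) * √(q : ℝ) ^ (k + 2)) := by
  have hq1 : (1 : ℝ) ≤ q := by exact_mod_cast (by omega : 1 ≤ q)
  have hcard : (Fintype.card V : ℝ) * ((k + 3) * √(q : ℝ) ^ (k + 2)) =
      ∑ _i : Fin (Fintype.card V), (k + 3) * √(q : ℝ) ^ (k + 2) := by
    simp
  rw [PX_eq_sum_eval_nbPoly hG hlam, hcard, ← Finset.sum_add_distrib, ← nsmul_eq_mul,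
    ← Finset.sum_const, Finset.sum_filter]
  refine Finset.sum_le_sum fun i _ => ?_
  split_ifs with h
  · have h1 := rpow_pow_le_eval_nbPoly hq hp h hk
    have h2 : 0 ≤ (k + 3) * √(q : ℝ) ^ (k + 2) := by positivity
    linarith
  · have := neg_le_eval_nbPoly hq1 (((q : ℝ) + 1) * lam i) hk
    linarith

theorem two_mul_logb_add_one_le {q x ε : ℝ} (hq : 1 < q) (hx : 1 ≤ x) (hε : 0 < ε) :
    2 * Real.logb q x + 1 ≤ (2 / (ε * Real.log q) + 1) * x ^ ε := by
  have hlog : 0 < Real.log q := Real.log_pos hq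
  have h1 : Real.log x ≤ x ^ ε / ε := Real.log_le_rpow_div (by linarith) hε
  have h2 : 1 ≤ x ^ ε := Real.one_le_rpow hx hε.le
  have h3 : Real.logb q x ≤ x ^ ε / ε / Real.log q := by
    rw [Real.logb]
    gcongr
  calc 2 * Real.logb q x + 1 ≤ 2 * (x ^ ε / ε / Real.log q) + x ^ ε := by linarith
    _ = (2 / (ε * Real.log q) + 1) * x ^ ε := by
      field_simp

theorem le_of_mul_rpow_le {q x A p B N : ℝ} (hq : 1 < q) (hx : 1 ≤ x) (hp : 2 < p) (hB : 0 ≤ B)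
    {j : ℕ} (hj : A * Real.logb q x - 1 ≤ j)
    (h : N * (q ^ (1 - 1 / p)) ^ (2 * j) ≤ B * √q ^ (2 * j)) :
    N ≤ B * (q ^ (1 - 2 / p) * x ^ (-(A * (1 - 2 / p)))) := by
  have hq0 : 0 < q := by linarith
  have hx0 : 0 < x := by linarith
  have hp2 : 0 ≤ 1 - 2 / p := by
    rw [sub_nonneg, div_le_one (by linarith)]
    exact hp.le
  have hpow : (q ^ (1 - 1 / p)) ^ (2 * j) = q ^ (j * (1 - 2 / p)) * √q ^ (2 * j) := by
    rw [pow_mul √q, Real.sq_sqrt hq0.le, ← Real.rpow_natCast, ← Real.rpow_natCast,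
      ← Real.rpow_mul hq0.le, ← Real.rpow_add hq0]
    congr 1
    push_cast
    ring
  rw [hpow, ← mul_assoc] at h
  have h1 : N * q ^ (j * (1 - 2 / p)) ≤ B := le_of_mul_le_mul_right h (by positivity)
  have h2 : N ≤ B * q ^ (-(j * (1 - 2 / p))) := by
    rw [Real.rpow_neg hq0.le, ← div_eq_mul_inv, le_div_iff₀ (by positivity)]
    exact h1
  refine h2.trans (mul_le_mul_of_nonneg_left ?_ hB)
  have hx' : x ^ (-(A * (1 - 2 / p))) = q ^ (Real.logb q x * (-(A * (1 - 2 / p)))) := by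
    rw [Real.rpow_mul hq0.le, Real.rpow_logb hq0 hq.ne' hx0]
  rw [hx', ← Real.rpow_add hq0]
  refine Real.rpow_le_rpow_of_exponent_le hq.le ?_
  nlinarith [mul_le_mul_of_nonneg_right hj hp2]

end Density

/-- The Sarnak–Xue weak injective radius property with parameter `A`
(`P(X,k) ≪_ε n^{1+ε} q^{k/2}` for `k ≤ 2A log_q n`) implies the Sarnak–Xue density
property with parameter `A`. -/
theorem stmt10 (q : ℕ) (hq : 2 ≤ q) (A : ℝ) (hA0 : 0 < A) (hA1 : A ≤ 1)
    (V : ℕ → Type) [∀ m, Fintype (V m)] [∀ m, Nonempty (V m)]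
    (G : ∀ m, SimpleGraph (V m))
    (hreg : ∀ m, (G m).IsRegularOfDegree (q + 1))
    (lam : ∀ m, Fin (Fintype.card (V m)) → ℝ)
    (hev : ∀ m, ((G m).adjMatrix ℝ).charpoly =
      ∏ i, (Polynomial.X - Polynomial.C (((q : ℝ) + 1) * lam m i)))
    (hinj : ∀ ε : ℝ, 0 < ε → ∃ C : ℝ, 0 < C ∧ ∀ m, ∀ k : ℕ, 1 ≤ k →
      (k : ℝ) ≤ 2 * A * Real.logb q (Fintype.card (V m)) →
      (PX (G m) k : ℝ)
        ≤ C * (Fintype.card (V m) : ℝ) ^ (1 + ε) * (q : ℝ) ^ ((k : ℝ) / 2)) :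
    ∀ p : ℝ, 2 < p → ∀ ε : ℝ, 0 < ε → ∃ C : ℝ, 0 < C ∧ ∀ m,
      ((Finset.univ.filter (fun i => pexp q (lam m i) ≤ 1 / p)).card : ℝ)
        ≤ C * (Fintype.card (V m) : ℝ) ^ (1 - A * (1 - 2 / p) + ε) := by
  intro p hp ε hε
  obtain ⟨C₀, hC₀, hinj⟩ := hinj ε hε
  have hq1 : (1 : ℝ) < q := by exact_mod_cast (by omega : 1 < q)
  have hq0 : (0 : ℝ) < q := by linarith
  have hlog : 0 < Real.log q := Real.log_pos hq1
  refine ⟨(C₀ + (2 / (ε * Real.log q) + 1)) * (q : ℝ) ^ (1 - 2 / p), by positivity, fun m => ?_⟩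
  set n : ℝ := (Fintype.card (V m) : ℝ) with hn
  have hn1 : 1 ≤ n := Nat.one_le_cast.2 Fintype.card_pos
  have hn0 : 0 < n := by linarith
  have hL : 0 ≤ Real.logb q n := Real.logb_nonneg hq1 hn1
  have hnε : n ^ (1 + ε) = n * n ^ ε := by rw [Real.rpow_add hn0, Real.rpow_one]
  set j : ℕ := ⌊A * Real.logb q n⌋₊ with hj
  have hjle : (j : ℝ) ≤ A * Real.logb q n := Nat.floor_le (by positivity)
  have hjlt : A * Real.logb q n - 1 ≤ j := (Nat.sub_one_lt_floor _).le
  have hjn : n * (2 * j + 1) ≤ (2 / (ε * Real.log q) + 1) * n ^ (1 + ε) := by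
    have h1 := two_mul_logb_add_one_le hq1 hn1 hε
    have h2 : (2 * j + 1 : ℝ) ≤ (2 / (ε * Real.log q) + 1) * n ^ ε := by nlinarith
    calc n * (2 * j + 1) ≤ n * ((2 / (ε * Real.log q) + 1) * n ^ ε) := by gcongr
      _ = _ := by rw [hnε]; ring
  have key : ((Finset.univ.filter (fun i => pexp q (lam m i) ≤ 1 / p)).card : ℝ) *
      ((q : ℝ) ^ (1 - 1 / p)) ^ (2 * j) ≤
      (C₀ + (2 / (ε * Real.log q) + 1)) * n ^ (1 + ε) * √(q : ℝ) ^ (2 * j) := by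
    rcases Nat.eq_zero_or_pos j with h0 | hpos
    · rw [h0] at hjn ⊢
      have hcard : ((Finset.univ.filter (fun i => pexp q (lam m i) ≤ 1 / p)).card : ℝ) ≤ n := by
        rw [hn]
        exact_mod_cast (Finset.card_filter_le _ _).trans (by simp)
      have : 0 ≤ C₀ * n ^ (1 + ε) := by positivity
      simp only [Nat.cast_zero, mul_zero, zero_add, mul_one, pow_zero] at hjn ⊢
      linarith
    · obtain ⟨i, hi⟩ : ∃ i, j = i + 1 := ⟨j - 1, by omega⟩
      have hmain := card_mul_rpow_le hq (hreg m) (hev m) hp (even_two_mul i)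
      have hk : 2 * i + 2 = 2 * j := by omega
      rw [hk] at hmain
      have hP := hinj m (2 * j) (by omega) (by push_cast; linarith)
      have hsqrt : (q : ℝ) ^ (((2 * j : ℕ) : ℝ) / 2) = √(q : ℝ) ^ (2 * j) := by
        rw [pow_mul, Real.sq_sqrt hq0.le, ← Real.rpow_natCast]
        congr 1
        push_cast
        ring
      rw [hsqrt] at hP
      have hcast : (((2 * i : ℕ) : ℝ) + 3) = 2 * j + 1 := by
        rw [hi]
        push_cast
        ring
      rw [hcast] at hmain
      calc _ ≤ _ := hmain
        _ ≤ C₀ * n ^ (1 + ε) * √(q : ℝ) ^ (2 * j) + n * (2 * j + 1) * √(q : ℝ) ^ (2 * j) := by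
          rw [mul_assoc n]
          gcongr
        _ ≤ C₀ * n ^ (1 + ε) * √(q : ℝ) ^ (2 * j) +
            (2 / (ε * Real.log q) + 1) * n ^ (1 + ε) * √(q : ℝ) ^ (2 * j) := by gcongr
        _ = _ := by ring
  refine (le_of_mul_rpow_le hq1 hn1 hp (by positivity) hjlt key).trans_eq ?_
  have hexp : 1 - A * (1 - 2 / p) + ε = (1 + ε) + -(A * (1 - 2 / p)) := by ring
  rw [hexp, Real.rpow_add hn0 (1 + ε)]
  ring
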